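/- Let m, n, r be positive integers with r ≤ m ≤ n, let A ∈ ℝ^{m×n} have rank r, and let M ∈ ℝ^{n×n} be symmetric positive definite. Then [A (M + AᵀA)⁻¹ Aᵀ]† A = [I_m + (A M⁻¹ Aᵀ)†] A. -/

import Mathlib

open Matrix

/-- `B` is the Moore–Penrose pseudoinverse of `A`. -/
def IsMoorePenroseInv {m n : ℕ} (A : Matrix (Fin m) (Fin n) ℝ)
    (B : Matrix (Fin n) (Fin m) ℝ) : Prop :=
  A * B * A = A ∧ B * A * B = B ∧ (A * B)ᵀ = A * B ∧ (B * A)ᵀ = B * A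

theorem aux_range {m n : ℕ} (A : Matrix (Fin m) (Fin n) ℝ) (K : Matrix (Fin n) (Fin n) ℝ)
    (hK : K.PosDef) (Q : Matrix (Fin m) (Fin m) ℝ)
    (h : A * K * Aᵀ * Q * (A * K * Aᵀ) = A * K * Aᵀ) : A * K * Aᵀ * Q * A = A := by
  set Y := A * K * Aᵀ * Q - 1 with hY
  have h1 : Y * A * K * Aᵀ = 0 := by
    have : Y * A * K * Aᵀ = A * K * Aᵀ * Q * (A * K * Aᵀ) - A * K * Aᵀ := by
      rw [hY]; simp only [Matrix.sub_mul, Matrix.one_mul, Matrix.mul_assoc]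
    rw [this, h, sub_self]
  have h2 : (Y * A) * K * (Y * A)ᵀ = 0 := by
    rw [Matrix.transpose_mul, ← Matrix.mul_assoc, h1, Matrix.zero_mul]
  have h3 : Y * A = 0 := by
    generalize Y * A = X at h2
    ext i j
    by_contra hne
    have hx : X i ≠ 0 := fun h0 => hne (by rw [h0]; rfl)
    have hp := hK.dotProduct_mulVec_pos hx
    have h0 := congrFun (congrFun h2 i) i
    rw [Matrix.mul_assoc, Matrix.mul_apply_eq_vecMul] at h0
    have h4 : X i ⬝ᵥ (K *ᵥ X i) = 0 := by
      simpa [Matrix.vecMul, Matrix.mulVec, dotProduct, Matrix.mul_apply] using h0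
    rw [star_trivial] at hp
    exact hp.ne' h4
  rw [hY, Matrix.sub_mul, Matrix.one_mul] at h3
  exact sub_eq_zero.mp h3

theorem aux_range' {m n : ℕ} (A : Matrix (Fin m) (Fin n) ℝ) (K : Matrix (Fin n) (Fin n) ℝ)
    (hK : K.PosDef) (Q : Matrix (Fin m) (Fin m) ℝ)
    (h : IsMoorePenroseInv (A * K * Aᵀ) Q) :
    Q * (A * K * Aᵀ) = A * K * Aᵀ * Qᵀ ∧ Q * (A * K * Aᵀ) * A = A := by
  have hKt : Kᵀ = K := by simpa using hK.isHermitian.eq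
  have hS : (A * K * Aᵀ)ᵀ = A * K * Aᵀ := by
    simp [Matrix.transpose_mul, hKt, Matrix.mul_assoc]
  obtain ⟨h1, -, -, h4⟩ := h
  have h5 : Q * (A * K * Aᵀ) = A * K * Aᵀ * Qᵀ := by
    rw [← h4, Matrix.transpose_mul, hS]
  refine ⟨h5, ?_⟩
  rw [h5]
  apply aux_range A K hK
  clear h4 h5
  generalize A * K * Aᵀ = S at *
  have := congrArg Matrix.transpose h1
  rwa [Matrix.transpose_mul, Matrix.transpose_mul, hS, ← Matrix.mul_assoc] at this

theorem pinv_identity_one (m n r : ℕ) (hr : 0 < r) (hrm : r ≤ m) (hmn : m ≤ n)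
    (A : Matrix (Fin m) (Fin n) ℝ) (hrank : A.rank = r)
    (M : Matrix (Fin n) (Fin n) ℝ) (hM : M.PosDef)
    (P : Matrix (Fin m) (Fin m) ℝ)
    (hP : IsMoorePenroseInv (A * (M + Aᵀ * A)⁻¹ * Aᵀ) P)
    (Q : Matrix (Fin m) (Fin m) ℝ)
    (hQ : IsMoorePenroseInv (A * M⁻¹ * Aᵀ) Q) :
    P * A = (1 + Q) * A := by
  have hN : (M + Aᵀ * A).PosDef := by
    apply hM.add_posSemidef
    simpa using Matrix.posSemidef_conjTranspose_mul_self A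
  have hMu : IsUnit M.det := (Matrix.isUnit_iff_isUnit_det _).mp hM.isUnit
  have hNu : IsUnit (M + Aᵀ * A).det := (Matrix.isUnit_iff_isUnit_det _).mp hN.isUnit
  have hSQA := aux_range A _ hM.inv Q hQ.1
  obtain ⟨hQS, -⟩ := aux_range' A _ hM.inv Q hQ
  obtain ⟨-, hPTA⟩ := aux_range' A _ hN.inv P hP
  have hQ2 := hQ.2.1
  have hkey : A * (M + Aᵀ * A)⁻¹ * Aᵀ * (1 + A * M⁻¹ * Aᵀ) = A * M⁻¹ * Aᵀ := by
    have e : Aᵀ * (1 + A * M⁻¹ * Aᵀ) = (M + Aᵀ * A) * (M⁻¹ * Aᵀ) := by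
      rw [Matrix.add_mul, Matrix.mul_nonsing_inv_cancel_left _ _ hMu]
      simp [Matrix.mul_add, Matrix.mul_assoc]
    rw [Matrix.mul_assoc, e, Matrix.mul_assoc, Matrix.nonsing_inv_mul_cancel_left _ _ hNu,
      Matrix.mul_assoc]
  have hPTQ : P * (A * (M + Aᵀ * A)⁻¹ * Aᵀ) * Q = Q := by
    have e : Q = A * (M⁻¹ * Aᵀ * Qᵀ * Q) := by
      conv_lhs => rw [← hQ2, hQS]
      simp only [Matrix.mul_assoc]
    rw [e, ← Matrix.mul_assoc, hPTA]
  generalize A * (M + Aᵀ * A)⁻¹ * Aᵀ = T at *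
  generalize A * M⁻¹ * Aᵀ = S at *
  calc P * A = P * (S * Q * A) := by rw [hSQA]
    _ = P * (T * (1 + S) * Q * A) := by rw [hkey]
    _ = P * T * Q * A + P * T * (S * Q * A) := by
      simp only [Matrix.mul_add, Matrix.add_mul, Matrix.mul_one, Matrix.mul_assoc]
    _ = (1 + Q) * A := by
      rw [hSQA, hPTQ, hPTA, Matrix.add_mul, Matrix.one_mul, add_comm]
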